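/- Let C_0(T_3) = {ψ ∈ C(T_3, ℝ) : ψ(−1,0,0) = 0} and C_{0,V} = C_0(T_3) ⊕ V. Then B_0, B_1 and B = B_0 + B_1 map C_V into C_{0,V}. In particular, for every φ ∈ C_V one has, at every θ ∈ T_3 ∖ {(−1,0,0)}, (Bφ)(θ) = Q_0·ν_0(θ) + Q_1·ν_1(θ) + ψ(θ), where ψ ∈ C_0(T_3), Q_0 = (1/2)·∫_{−1}^0 t²·(1+t)·φ(t,0,0) dt, and Q_1 = ∫_{−1}^0 t²·(1+t)·φ(−1,t,0) dt. Moreover, every pair (Q_0, Q_1) ∈ ℝ² arises in this way from some φ ∈ C(T_3,ℝ); consequently C_V is the smallest closed subspace of the bounded functions on T_3 ∖ {(−1,0,0)} (with the supremum norm) which contains the restrictions of all functions in C(T_3,ℝ) and is invariant under B. -/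

import Mathlib

open MeasureTheory

noncomputable section

/-- The average integral `⨏_a^b f`, with the convention `⨏_a^a f = f a`. -/
def avg (a b : ℝ) (f : ℝ → ℝ) : ℝ :=
  if a = b then f a else (b - a)⁻¹ * ∫ x in a..b, f x

/-- The simplex `T₃ = {θ ∈ [-1,0]³ : θ₁ ≤ θ₂ ≤ θ₃}`. -/
def T3set : Set (ℝ × ℝ × ℝ) :=
  {p | -1 ≤ p.1 ∧ p.1 ≤ p.2.1 ∧ p.2.1 ≤ p.2.2 ∧ p.2.2 ≤ 0}

/-- The exceptional point `(-1, 0, 0)`. -/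
def badPt : ℝ × ℝ × ℝ := (-1, 0, 0)

/-- The kernel `Φ₀`. -/
def Phi0 (t₁ t₂ θ₁ θ₂ θ₃ : ℝ) : ℝ :=
  ((t₂ - t₁) / (θ₃ - θ₁)) * t₁ * (t₂ / (1 + θ₁ - θ₂)) * (1 + t₁ - t₂)

/-- The kernel `Φ₁`. -/
def Phi1 (t₀ t₁ t₂ θ₁ θ₃ : ℝ) : ℝ :=
  (t₁ - t₀) * ((t₂ - t₁) / (θ₃ - θ₁)) * (t₂ - t₀) * (1 + t₀ - t₁)

/-- The operator `B₀`, extended to totally degenerate points `(θ⋆,θ⋆,θ⋆)` by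
`(B₀φ)(θ⋆,θ⋆,θ⋆) = θ⋆² φ(θ⋆,θ⋆,0)/2`. -/
def B0op (φ : ℝ × ℝ × ℝ → ℝ) (p : ℝ × ℝ × ℝ) : ℝ :=
  if p.1 = p.2.2 then p.1 ^ 2 * φ (p.1, p.1, 0) / 2
  else avg p.1 p.2.1 fun t₁ => avg p.2.1 p.2.2 fun t₂ =>
    Phi0 t₁ t₂ p.1 p.2.1 p.2.2 * φ (t₁, t₂, 0)

/-- The operator `B̃₁`, extended to totally degenerate points `(θ⋆,θ⋆,θ⋆)` by
`(B̃₁φ)(θ⋆,θ⋆,θ⋆) = (1/2) ⨏_{-1}^{θ⋆} (θ⋆-t)² (1+t-θ⋆) φ(t,θ⋆,θ⋆) dt`. -/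
def Bt1op (φ : ℝ × ℝ × ℝ → ℝ) (p : ℝ × ℝ × ℝ) : ℝ :=
  if p.1 = p.2.2 then
    (1 / 2) * avg (-1) p.1 fun t => (p.1 - t) ^ 2 * (1 + t - p.1) * φ (t, p.1, p.1)
  else avg (-1) p.1 fun t₀ => avg p.1 p.2.1 fun t₁ => avg p.2.1 p.2.2 fun t₂ =>
    Phi1 t₀ t₁ t₂ p.1 p.2.2 * φ (t₀, t₁, t₂)

/-- `ν₀(θ) = -(θ₂+θ₃)/(1+θ₁-θ₂)`. -/
def nu0 (p : ℝ × ℝ × ℝ) : ℝ := -(p.2.1 + p.2.2) / (1 + p.1 - p.2.1)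

/-- `ν₁(θ) = (1+θ₁)/(1+θ₁-θ₂)`. -/
def nu1 (p : ℝ × ℝ × ℝ) : ℝ := (1 + p.1) / (1 + p.1 - p.2.1)

/-- The operator `B₁ = ν₁ ⬝ B̃₁`. -/
def B1op (φ : ℝ × ℝ × ℝ → ℝ) (p : ℝ × ℝ × ℝ) : ℝ := nu1 p * Bt1op φ p

/-- The operator `B = B₀ + B₁`. -/
def Bop3 (φ : ℝ × ℝ × ℝ → ℝ) : ℝ × ℝ × ℝ → ℝ :=
  fun p => B0op φ p + B1op φ p

/-- Membership in `C_V = C(T₃)|_{T₃ ∖ {(-1,0,0)}} ⊕ span{ν₀, ν₁}` (only the values of `φ`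
on `T₃ ∖ {(-1,0,0)}` are relevant). -/
def InCV (φ : ℝ × ℝ × ℝ → ℝ) : Prop :=
  ∃ ψ : ℝ × ℝ × ℝ → ℝ, ContinuousOn ψ T3set ∧ ∃ c₀ c₁ : ℝ,
    ∀ p ∈ T3set \ {badPt}, φ p = ψ p + c₀ * nu0 p + c₁ * nu1 p

/-- The punctured simplex `T₃ ∖ {(-1,0,0)}`. -/
def Dset : Set (ℝ × ℝ × ℝ) := T3set \ {badPt}

/-- Membership in `C_{0,V} = C₀(T₃)|_{T₃ ∖ {(-1,0,0)}} ⊕ span{ν₀, ν₁}`. -/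
def InC0V (φ : ℝ × ℝ × ℝ → ℝ) : Prop :=
  ∃ ψ : ℝ × ℝ × ℝ → ℝ, ContinuousOn ψ T3set ∧ ψ badPt = 0 ∧ ∃ c₀ c₁ : ℝ,
    ∀ p ∈ Dset, φ p = ψ p + c₀ * nu0 p + c₁ * nu1 p

/-- `Q₀(φ) = (1/2) ∫_{-1}^0 t² (1+t) φ(t,0,0) dt`. -/
def Q0 (φ : ℝ × ℝ × ℝ → ℝ) : ℝ :=
  (1 / 2) * ∫ t in (-1 : ℝ)..0, t ^ 2 * (1 + t) * φ (t, 0, 0)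

/-- `Q₁(φ) = ∫_{-1}^0 t² (1+t) φ(-1,t,0) dt`. -/
def Q1 (φ : ℝ × ℝ × ℝ → ℝ) : ℝ :=
  ∫ t in (-1 : ℝ)..0, t ^ 2 * (1 + t) * φ (-1, t, 0)

open Set Filter Topology

lemma avg_eq (a b : ℝ) (f : ℝ → ℝ) :
    avg a b f = ∫ s in Ioo (0:ℝ) 1, f (a + s * (b - a)) := by
  rw [← integral_Ioc_eq_integral_Ioo, ← intervalIntegral.integral_of_le zero_le_one]
  unfold avg
  split_ifs with h
  · subst h; simp
  · have h' : b - a ≠ 0 := sub_ne_zero.mpr (Ne.symm h)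
    have := intervalIntegral.integral_comp_add_mul (a := 0) (b := 1) f h' a
    simp only [mul_comm _ (b - a)]
    rw [this]; simp

lemma CI {X : Type*} [TopologicalSpace X] [FirstCountableTopology X] {A : Set X}
    {F : X → ℝ → ℝ} {M : ℝ}
    (hc : ContinuousOn (fun q : X × ℝ => F q.1 q.2) (A ×ˢ Ioo (0:ℝ) 1))
    (hb : ∀ x ∈ A, ∀ r ∈ Ioo (0:ℝ) 1, |F x r| ≤ M) :
    ContinuousOn (fun x => ∫ r in Ioo (0:ℝ) 1, F x r) A ∧
    (∀ x ∈ A, |∫ r in Ioo (0:ℝ) 1, F x r| ≤ M) ∧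
    (∀ x ∈ A, IntegrableOn (F x) (Ioo (0:ℝ) 1)) := by
  have hm : ∀ x ∈ A, AEStronglyMeasurable (F x) (volume.restrict (Ioo (0:ℝ) 1)) := by
    intro x hx
    apply ContinuousOn.aestronglyMeasurable _ measurableSet_Ioo
    exact hc.comp (f := fun r : ℝ => (x, r)) (by fun_prop) (fun r hr => ⟨hx, hr⟩)
  have hae : ∀ x ∈ A, ∀ᵐ r ∂(volume.restrict (Ioo (0:ℝ) 1)), ‖F x r‖ ≤ M := by
    intro x hx
    filter_upwards [ae_restrict_mem measurableSet_Ioo] with r hr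
    exact hb x hx r hr
  refine ⟨?_, ?_, ?_⟩
  · apply continuousOn_of_dominated (bound := fun _ => M) hm hae
    · exact integrable_const M
    · filter_upwards [ae_restrict_mem measurableSet_Ioo] with r hr
      exact hc.comp (f := fun x : X => (x, r)) (by fun_prop) (fun x hx => ⟨hx, hr⟩)
  · intro x hx
    have := norm_integral_le_of_norm_le_const (hae x hx)
    simpa using this
  · intro x hx
    exact Integrable.mono' (integrable_const M) (hm x hx) (hae x hx)

def Nice {X : Type*} [TopologicalSpace X] (A : Set X) (F : X → ℝ → ℝ → ℝ) : Prop :=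
  ContinuousOn (fun q : (X × ℝ) × ℝ => F q.1.1 q.1.2 q.2) ((A ×ˢ Ioo (0:ℝ) 1) ×ˢ Ioo (0:ℝ) 1) ∧
  ∃ M, ∀ x ∈ A, ∀ s ∈ Ioo (0:ℝ) 1, ∀ r ∈ Ioo (0:ℝ) 1, |F x s r| ≤ M

def mom {X : Type*} (w : ℝ → ℝ → ℝ) (F : X → ℝ → ℝ → ℝ) (x : X) : ℝ :=
  ∫ s in Ioo (0:ℝ) 1, ∫ r in Ioo (0:ℝ) 1, w s r * F x s r

lemma Nice.wmul {X : Type*} [TopologicalSpace X] {A : Set X} {F : X → ℝ → ℝ → ℝ}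
    (h : Nice A F) {w : ℝ → ℝ → ℝ} (hw : Continuous fun q : ℝ × ℝ => w q.1 q.2) :
    Nice A (fun x s r => w s r * F x s r) := by
  obtain ⟨hc, M, hM⟩ := h
  refine ⟨?_, ?_⟩
  · apply ContinuousOn.mul _ hc
    exact (hw.comp (f := fun q : (X × ℝ) × ℝ => (q.1.2, q.2)) (by fun_prop)).continuousOn
  · obtain ⟨K, hK⟩ := ((isCompact_Icc (a := (0:ℝ)) (b := 1)).prod
      (isCompact_Icc (a := (0:ℝ)) (b := 1))).exists_bound_of_continuousOn hw.continuousOn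
    refine ⟨K * M, fun x hx s hs r hr => ?_⟩
    have h1 := hK (s, r) ⟨Ioo_subset_Icc_self hs, Ioo_subset_Icc_self hr⟩
    simp only [Real.norm_eq_abs] at h1
    rw [abs_mul]
    exact mul_le_mul h1 (hM x hx s hs r hr) (abs_nonneg _) ((abs_nonneg _).trans h1)

lemma mom_cont {X : Type*} [TopologicalSpace X] [FirstCountableTopology X] {A : Set X}
    {F : X → ℝ → ℝ → ℝ}
    (h : Nice A F) {w : ℝ → ℝ → ℝ} (hw : Continuous fun q : ℝ × ℝ => w q.1 q.2) :
    ContinuousOn (mom w F) A ∧ ∃ M, ∀ x ∈ A, |mom w F x| ≤ M := by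
  obtain ⟨hc, M, hM⟩ := h.wmul hw
  obtain ⟨c1, b1, -⟩ := CI (A := A ×ˢ Ioo (0:ℝ) 1)
    (F := fun q r => w q.2 r * F q.1 q.2 r) (M := M) hc (fun x hx r hr => hM x.1 hx.1 x.2 hx.2 r hr)
  obtain ⟨c2, b2, -⟩ := CI (A := A)
    (F := fun x s => ∫ r in Ioo (0:ℝ) 1, w s r * F x s r) (M := M) c1
    (fun x hx r hr => b1 (x, r) ⟨hx, hr⟩)
  exact ⟨c2, M, b2⟩

lemma mom_lin {X : Type*} [TopologicalSpace X] [FirstCountableTopology X] {A : Set X}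
    {F : X → ℝ → ℝ → ℝ}
    (h : Nice A F) {w₁ w₂ : ℝ → ℝ → ℝ} (hw₁ : Continuous fun q : ℝ × ℝ => w₁ q.1 q.2)
    (hw₂ : Continuous fun q : ℝ × ℝ => w₂ q.1 q.2) (a b : ℝ) {x : X} (hx : x ∈ A) :
    mom (fun s r => a * w₁ s r + b * w₂ s r) F x = a * mom w₁ F x + b * mom w₂ F x := by
  have key : ∀ {w : ℝ → ℝ → ℝ}, (Continuous fun q : ℝ × ℝ => w q.1 q.2) →
      (∀ s ∈ Ioo (0:ℝ) 1, IntegrableOn (fun r => w s r * F x s r) (Ioo 0 1)) ∧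
      IntegrableOn (fun s => ∫ r in Ioo (0:ℝ) 1, w s r * F x s r) (Ioo 0 1) := by
    intro w hw
    obtain ⟨hc, M, hM⟩ := h.wmul hw
    obtain ⟨c1, b1, i1⟩ := CI (A := A ×ˢ Ioo (0:ℝ) 1)
      (F := fun q r => w q.2 r * F q.1 q.2 r) (M := M) hc
      (fun x hx r hr => hM x.1 hx.1 x.2 hx.2 r hr)
    obtain ⟨-, -, i2⟩ := CI (A := A)
      (F := fun x s => ∫ r in Ioo (0:ℝ) 1, w s r * F x s r) (M := M) c1
      (fun x hx r hr => b1 (x, r) ⟨hx, hr⟩)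
    exact ⟨fun s hs => i1 (x, s) ⟨hx, hs⟩, i2 x hx⟩
  obtain ⟨i1, j1⟩ := key hw₁
  obtain ⟨i2, j2⟩ := key hw₂
  unfold mom
  rw [← integral_const_mul, ← integral_const_mul, ← integral_add (j1.const_mul a) (j2.const_mul b)]
  apply setIntegral_congr_fun measurableSet_Ioo
  intro s hs
  simp only
  rw [← integral_const_mul, ← integral_const_mul,
    ← integral_add ((i1 s hs).const_mul a) ((i2 s hs).const_mul b)]
  congr 1; ext r; ring

lemma mul_zero_cont {X : Type*} [TopologicalSpace X] {A : Set X} {u h : X → ℝ} {x : X} {K : ℝ}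
    (hu : ∀ y ∈ A, |u y| ≤ K) (hh : ContinuousWithinAt h A x) (h0 : h x = 0) :
    ContinuousWithinAt (fun y => u y * h y) A x := by
  unfold ContinuousWithinAt
  simp only [h0, mul_zero]
  have hh' : Tendsto h (𝓝[A] x) (𝓝 0) := by rw [← h0]; exact hh
  apply squeeze_zero_norm' (a := fun y => K * |h y|)
  · filter_upwards [self_mem_nhdsWithin] with y hy
    rw [norm_mul]
    exact mul_le_mul_of_nonneg_right (hu y hy) (abs_nonneg _)
  · simpa using hh'.abs.const_mul K

lemma int_pow (n : ℕ) : ∫ r in Ioo (0:ℝ) 1, r ^ n = 1 / (n + 1) := by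
  rw [← integral_Ioc_eq_integral_Ioo, ← intervalIntegral.integral_of_le zero_le_one]
  simp [integral_pow]

/-- the ratio -/
def lam (p : ℝ × ℝ × ℝ) : ℝ := (p.2.1 - p.1) / (p.2.2 - p.1)

lemma lam_bd {p : ℝ × ℝ × ℝ} (hp : p ∈ T3set) : |lam p| ≤ 1 := by
  obtain ⟨h1, h2, h3, h4⟩ := hp
  unfold lam
  rw [abs_of_nonneg (div_nonneg (by linarith) (by linarith))]
  exact div_le_one_of_le₀ (by linarith) (by linarith)

lemma lam_cont {p : ℝ × ℝ × ℝ} (hp : p.1 ≠ p.2.2) (A) : ContinuousWithinAt lam A p := by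
  unfold lam
  apply ContinuousAt.continuousWithinAt
  apply ContinuousAt.div (by fun_prop) (by fun_prop)
  exact sub_ne_zero.mpr (Ne.symm hp)

lemma d_pos {p : ℝ × ℝ × ℝ} (hp : p ∈ Dset) : 0 < 1 + p.1 - p.2.1 := by
  obtain ⟨⟨h1, h2, h3, h4⟩, h5⟩ := hp
  by_contra h
  apply h5
  obtain ⟨a, b, c⟩ := p
  simp only [badPt, mem_singleton_iff, Prod.mk.injEq] at *
  refine ⟨?_, ?_, ?_⟩ <;> linarith

lemma d_nonneg {p : ℝ × ℝ × ℝ} (hp : p ∈ T3set) : 0 ≤ 1 + p.1 - p.2.1 := by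
  obtain ⟨h1, h2, h3, h4⟩ := hp
  linarith

lemma nu0_cont : ContinuousOn nu0 Dset := by
  intro p hp
  unfold nu0
  apply ContinuousAt.continuousWithinAt
  exact ContinuousAt.div (by fun_prop) (by fun_prop) (d_pos hp).ne'

lemma nu1_cont : ContinuousOn nu1 Dset := by
  intro p hp
  unfold nu1
  apply ContinuousAt.continuousWithinAt
  exact ContinuousAt.div (by fun_prop) (by fun_prop) (d_pos hp).ne'

lemma nu0_bd {p : ℝ × ℝ × ℝ} (hp : p ∈ T3set) : |nu0 p| ≤ 2 := by
  have hd := d_nonneg hp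
  obtain ⟨h1, h2, h3, h4⟩ := hp
  unfold nu0
  rw [abs_of_nonneg (div_nonneg (by linarith) (by linarith))]
  exact div_le_of_le_mul₀ (by linarith) (by linarith) (by linarith)

lemma nu1_bd {p : ℝ × ℝ × ℝ} (hp : p ∈ T3set) : |nu1 p| ≤ 1 := by
  have hd := d_nonneg hp
  obtain ⟨h1, h2, h3, h4⟩ := hp
  unfold nu1
  rw [abs_of_nonneg (div_nonneg (by linarith) (by linarith))]
  exact div_le_of_le_mul₀ (by linarith) (by linarith) (by linarith)

lemma T3_compact : IsCompact T3set := by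
  have hcl : IsClosed T3set := by
    unfold T3set
    simp only [ofPred_and]
    exact (isClosed_le (by fun_prop) (by fun_prop)).inter
      ((isClosed_le (by fun_prop) (by fun_prop)).inter
      ((isClosed_le (by fun_prop) (by fun_prop)).inter
      (isClosed_le (by fun_prop) (by fun_prop))))
  apply (isCompact_Icc (a := ((-1, -1, -1) : ℝ × ℝ × ℝ)) (b := (0, 0, 0))).of_isClosed_subset hcl
  rintro ⟨a, b, c⟩ ⟨h1, h2, h3, h4⟩
  simp only at h1 h2 h3 h4
  simp only [mem_Icc, Prod.mk_le_mk]
  refine ⟨⟨?_, ?_, ?_⟩, ?_, ?_, ?_⟩ <;> linarith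

lemma bad_mem : badPt ∈ T3set := by
  simp [badPt, T3set]

lemma T3_cases {p : ℝ × ℝ × ℝ} (hp : p ∈ T3set) : p ∈ Dset ∨ p = badPt := by
  by_cases h : p = badPt
  · exact Or.inr h
  · exact Or.inl ⟨hp, h⟩

lemma InCV_cont {φ} (h : InCV φ) : ContinuousOn φ Dset ∧ ∃ M, ∀ p ∈ Dset, |φ p| ≤ M := by
  obtain ⟨ψ, hψ, c0, c1, e⟩ := h
  refine ⟨?_, ?_⟩
  · have : ContinuousOn (fun p => ψ p + c0 * nu0 p + c1 * nu1 p) Dset :=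
      ((hψ.mono sdiff_subset).add (continuousOn_const.mul nu0_cont)).add
        (continuousOn_const.mul nu1_cont)
    exact this.congr e
  · obtain ⟨K, hK⟩ := T3_compact.exists_bound_of_continuousOn hψ
    refine ⟨K + |c0| * 2 + |c1| * 1, fun p hp => ?_⟩
    rw [e p hp]
    refine (abs_add_three _ _ _).trans ?_
    rw [abs_mul, abs_mul]
    gcongr
    · exact hK p hp.1
    · exact nu0_bd hp.1
    · exact nu1_bd hp.1

/-! closedness -/
lemma coef_bd {ψ : ℝ × ℝ × ℝ → ℝ} (hψ : ContinuousOn ψ T3set) {a b M : ℝ}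
    (h : ∀ p ∈ Dset, |ψ p + a * nu0 p + b * nu1 p| ≤ M) :
    |a| ≤ 2 * M ∧ |b| ≤ 4 * M ∧ |ψ badPt| ≤ 3 * M := by
  have key : ∀ (x y z c d : ℝ), 0 ≤ x → 0 ≤ z → z ≤ y → x + y = 1 →
      (∀ t, 0 < t → nu0 (-1 + t * x, -t * y, -t * z) = c) →
      (∀ t, 0 < t → nu1 (-1 + t * x, -t * y, -t * z) = d) →
      |ψ badPt + a * c + b * d| ≤ M := by
    intro x y z c d hx hz hzy hxy h0 h1
    have hev : ∀ᶠ t : ℝ in 𝓝[>] 0, (-1 + t * x, -t * y, -t * z) ∈ Dset := by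
      filter_upwards [Ioo_mem_nhdsGT (zero_lt_one)] with t ht
      obtain ⟨ht0, ht1⟩ := ht
      have := mul_nonneg ht0.le hx
      have := mul_nonneg ht0.le hz
      have := mul_le_mul_of_nonneg_left hzy ht0.le
      have e : t * x + t * y = t := by rw [← mul_add, hxy, mul_one]
      refine ⟨⟨by simp only; linarith, by simp only; linarith, by simp only; linarith,
        by simp only; linarith⟩, ?_⟩
      simp only [badPt, mem_singleton_iff, Prod.mk.injEq, not_and]
      intro e1 e2
      exfalso; linarith
    have ht : Tendsto (fun t : ℝ => ((-1 + t * x, -t * y, -t * z) : ℝ × ℝ × ℝ)) (𝓝[>] 0)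
        (𝓝[T3set] badPt) := by
      apply tendsto_nhdsWithin_of_tendsto_nhds_of_eventually_within
      · apply tendsto_nhdsWithin_of_tendsto_nhds
        have : Continuous (fun t : ℝ => ((-1 + t * x, -t * y, -t * z) : ℝ × ℝ × ℝ)) := by fun_prop
        simpa [badPt] using this.tendsto 0
      · filter_upwards [hev] with t ht using ht.1
    have hl := ((((hψ badPt bad_mem).tendsto.comp ht).add_const (a * c)).add_const (b * d)).abs
    apply le_of_tendsto hl
    filter_upwards [hev, self_mem_nhdsWithin] with t ht ht0
    have := h _ ht
    rw [h0 t ht0, h1 t ht0] at this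
    exact this
  have k1 := key 1 0 0 0 1 (by norm_num) (by norm_num) (by norm_num) (by norm_num)
    (by intro t ht; simp [nu0]) (by intro t ht; simp [nu1, ht.ne'])
  have k2 := key 0 1 0 1 0 (by norm_num) (by norm_num) (by norm_num) (by norm_num)
    (by intro t ht; simp [nu0, ht.ne']) (by intro t ht; simp [nu1])
  have k3 := key 0 1 1 2 0 (by norm_num) (by norm_num) (by norm_num) (by norm_num)
    (by intro t ht; simp [nu0]; field_simp; norm_num) (by intro t ht; simp [nu1])
  rw [abs_le] at *
  obtain ⟨k11, k12⟩ := k1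
  obtain ⟨k21, k22⟩ := k2
  obtain ⟨k31, k32⟩ := k3
  rw [abs_le, abs_le]
  refine ⟨⟨?_, ?_⟩, ⟨?_, ?_⟩, ?_, ?_⟩ <;> linarith

lemma CV_closed (f : ℝ × ℝ × ℝ → ℝ)
    (h : ∀ ε : ℝ, 0 < ε → ∃ g : ℝ × ℝ × ℝ → ℝ, InCV g ∧ ∀ p ∈ Dset, |f p - g p| ≤ ε) :
    InCV f := by
  have h' : ∀ n : ℕ, ∃ ψ : ℝ × ℝ × ℝ → ℝ, ContinuousOn ψ T3set ∧ ∃ c₀ c₁ : ℝ,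
      ∀ p ∈ Dset, |f p - (ψ p + c₀ * nu0 p + c₁ * nu1 p)| ≤ 1 / ((n:ℝ) + 1) := by
    intro n
    obtain ⟨g, ⟨ψ, hψ, c0, c1, e⟩, hg⟩ := h (1 / ((n:ℝ) + 1)) (by positivity)
    refine ⟨ψ, hψ, c0, c1, fun p hp => ?_⟩
    rw [← e p hp]; exact hg p hp
  choose ψ hψ a b hab using h'
  have hdiff : ∀ n m : ℕ, |a n - a m| ≤ 2 * (1 / ((n:ℝ) + 1) + 1 / ((m:ℝ) + 1)) ∧
      |b n - b m| ≤ 4 * (1 / ((n:ℝ) + 1) + 1 / ((m:ℝ) + 1)) ∧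
      |ψ n badPt - ψ m badPt| ≤ 3 * (1 / ((n:ℝ) + 1) + 1 / ((m:ℝ) + 1)) := by
    intro n m
    apply coef_bd (ψ := fun p => ψ n p - ψ m p) ((hψ n).sub (hψ m))
    intro p hp
    have h1 := abs_le.mp (hab n p hp)
    have h2 := abs_le.mp (hab m p hp)
    rw [abs_le]
    constructor <;> linarith [h1.1, h1.2, h2.1, h2.2]
  have cau : ∀ (u : ℕ → ℝ), (∀ n m : ℕ, |u n - u m| ≤ 4 * (1 / ((n:ℝ) + 1) + 1 / ((m:ℝ) + 1))) →
      ∃ l, Tendsto u atTop (𝓝 l) := by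
    intro u hu
    apply cauchySeq_tendsto_of_complete
    apply cauchySeq_of_le_tendsto_0 (b := fun N : ℕ => 8 * (1 / ((N:ℝ) + 1)))
    · intro n m N hn hm
      rw [Real.dist_eq]
      have h1 : 1 / ((n:ℝ) + 1) ≤ 1 / ((N:ℝ) + 1) := by gcongr
      have h2 : 1 / ((m:ℝ) + 1) ≤ 1 / ((N:ℝ) + 1) := by gcongr
      linarith [hu n m]
    · simpa using (tendsto_one_div_add_atTop_nhds_zero_nat (𝕜 := ℝ)).const_mul 8
  have pos : ∀ n m : ℕ, 0 < 1 / ((n:ℝ) + 1) + 1 / ((m:ℝ) + 1) := fun n m => by positivity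
  obtain ⟨A, hA⟩ := cau a (fun n m => (hdiff n m).1.trans (by linarith [pos n m]))
  obtain ⟨B, hB⟩ := cau b (fun n m => (hdiff n m).2.1)
  obtain ⟨C, hC⟩ := cau (fun n => ψ n badPt)
    (fun n m => (hdiff n m).2.2.trans (by linarith [pos n m]))
  classical
  refine ⟨fun p => if p = badPt then C else f p - A * nu0 p - B * nu1 p, ?_, A, B, ?_⟩
  · apply continuousOn_of_uniform_approx_of_continuousOn
    intro u hu
    obtain ⟨ε, hε, hu⟩ := Metric.mem_uniformity_dist.mp hu
    have hε' : 0 < ε / 5 := by positivity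
    obtain ⟨n, n1, n2, n3, n4⟩ := ((Metric.tendsto_nhds.mp hA _ hε').and
      ((Metric.tendsto_nhds.mp hB _ hε').and ((Metric.tendsto_nhds.mp hC _ hε').and
      (Metric.tendsto_nhds.mp (tendsto_one_div_add_atTop_nhds_zero_nat (𝕜 := ℝ)) _ hε')))).exists
    rw [Real.dist_eq] at n1 n2 n3 n4
    refine ⟨ψ n, hψ n, fun p hp => hu ?_⟩
    rw [Real.dist_eq]
    split_ifs with hpb
    · rw [hpb, abs_sub_comm]; linarith
    · have h1 := hab n p ⟨hp, hpb⟩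
      have e : f p - A * nu0 p - B * nu1 p - ψ n p =
        (f p - (ψ n p + a n * nu0 p + b n * nu1 p)) + (a n - A) * nu0 p + (b n - B) * nu1 p := by
        ring
      rw [e]
      refine (abs_add_three _ _ _).trans_lt ?_
      rw [abs_mul, abs_mul]
      have m1 : |a n - A| * |nu0 p| ≤ ε / 5 * 2 :=
        mul_le_mul n1.le (nu0_bd hp) (abs_nonneg _) hε'.le
      have m2 : |b n - B| * |nu1 p| ≤ ε / 5 * 1 :=
        mul_le_mul n2.le (nu1_bd hp) (abs_nonneg _) hε'.le
      rw [sub_zero] at n4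
      have := le_abs_self (1 / ((n:ℝ) + 1))
      linarith
  · intro p hp
    have : p ≠ badPt := hp.2
    simp only [if_neg this]; ring


def T1 (p : ℝ × ℝ × ℝ) (s : ℝ) : ℝ := p.1 + s * (p.2.1 - p.1)
def T2 (p : ℝ × ℝ × ℝ) (r : ℝ) : ℝ := p.2.1 + r * (p.2.2 - p.2.1)
def T0 (p : ℝ × ℝ × ℝ) (u : ℝ) : ℝ := -1 + u * (p.1 - -1)

def g0 (φ : ℝ × ℝ × ℝ → ℝ) (p : ℝ × ℝ × ℝ) (s r : ℝ) : ℝ :=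
  T1 p s * (1 + T1 p s - T2 p r) * φ (T1 p s, T2 p r, 0)

def g1 (φ : ℝ × ℝ × ℝ → ℝ) (q : (ℝ × ℝ × ℝ) × ℝ) (s r : ℝ) : ℝ :=
  (T1 q.1 s - T0 q.1 q.2) * (T2 q.1 r - T0 q.1 q.2) * (1 + T0 q.1 q.2 - T1 q.1 s) *
    φ (T0 q.1 q.2, T1 q.1 s, T2 q.1 r)

lemma T_bd {a b s : ℝ} (h : a ≤ b) (hs : s ∈ Ioo (0:ℝ) 1) :
    a ≤ a + s * (b - a) ∧ a + s * (b - a) ≤ b := by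
  obtain ⟨h0, h1⟩ := hs
  constructor <;> nlinarith

lemma T_eq_left {a b s : ℝ} (h : a ≤ b) (hs : s ∈ Ioo (0:ℝ) 1) (e : a + s * (b - a) ≤ a) :
    a = b := by
  obtain ⟨h0, h1⟩ := hs
  by_contra hne
  have : a < b := lt_of_le_of_ne h hne
  nlinarith [mul_pos h0 (sub_pos.mpr this)]

lemma T_eq_right {a b s : ℝ} (h : a ≤ b) (hs : s ∈ Ioo (0:ℝ) 1) (e : b ≤ a + s * (b - a)) :
    a = b := by
  obtain ⟨h0, h1⟩ := hs
  by_contra hne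
  have : a < b := lt_of_le_of_ne h hne
  nlinarith [mul_pos (sub_pos.mpr h1) (sub_pos.mpr this)]

lemma mem0 {p : ℝ × ℝ × ℝ} (hp : p ∈ T3set) {s r : ℝ} (hs : s ∈ Ioo (0:ℝ) 1)
    (hr : r ∈ Ioo (0:ℝ) 1) : (T1 p s, T2 p r, (0:ℝ)) ∈ Dset := by
  obtain ⟨h1, h2, h3, h4⟩ := hp
  obtain ⟨a1, a2⟩ := T_bd h2 hs
  obtain ⟨b1, b2⟩ := T_bd h3 hr
  refine ⟨⟨?_, ?_, ?_, le_refl _⟩, ?_⟩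
  · simp only [T1]; linarith
  · simp only [T1, T2]; linarith
  · simp only [T2]; linarith
  · simp only [badPt, mem_singleton_iff, Prod.mk.injEq, not_and, T1, T2]
    intro e1 e2
    have := T_eq_left h2 hs (by linarith)
    have := T_eq_right h3 hr (by linarith)
    exfalso; linarith

lemma mem1 {p : ℝ × ℝ × ℝ} (hp : p ∈ T3set) {u s r : ℝ} (hu : u ∈ Ioo (0:ℝ) 1)
    (hs : s ∈ Ioo (0:ℝ) 1)
    (hr : r ∈ Ioo (0:ℝ) 1) : (T0 p u, T1 p s, T2 p r) ∈ Dset := by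
  obtain ⟨h1, h2, h3, h4⟩ := hp
  obtain ⟨c1, c2⟩ := T_bd h1 hu
  obtain ⟨a1, a2⟩ := T_bd h2 hs
  obtain ⟨b1, b2⟩ := T_bd h3 hr
  refine ⟨⟨?_, ?_, ?_, ?_⟩, ?_⟩
  · simp only [T0]; linarith
  · simp only [T0, T1]; linarith
  · simp only [T1, T2]; linarith
  · simp only [T2]; linarith
  · simp only [badPt, mem_singleton_iff, Prod.mk.injEq, not_and, T0, T1, T2]
    intro e1 e2
    have := T_eq_left h1 hu (by linarith)
    have := T_eq_right h2 hs (by linarith)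
    exfalso; linarith

lemma abs_le_one_of {x : ℝ} (h : -1 ≤ x) (h' : x ≤ 1) : |x| ≤ 1 := abs_le.mpr ⟨h, h'⟩

lemma g0_nice {φ : ℝ × ℝ × ℝ → ℝ} (hc : ContinuousOn φ Dset) {M : ℝ}
    (hM : ∀ p ∈ Dset, |φ p| ≤ M) : Nice T3set (g0 φ) := by
  refine ⟨?_, M, ?_⟩
  · unfold g0
    apply ContinuousOn.mul
    · unfold T1 T2; fun_prop
    · apply hc.comp (f := fun q : ((ℝ × ℝ × ℝ) × ℝ) × ℝ => (T1 q.1.1 q.1.2, T2 q.1.1 q.2, (0:ℝ)))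
      · unfold T1 T2; fun_prop
      · intro q hq
        exact mem0 hq.1.1 hq.1.2 hq.2
  · intro p hp s hs r hr
    have hm := mem0 hp hs hr
    have := hM _ hm
    obtain ⟨⟨h1, h2, h3, h4⟩, -⟩ := hm
    simp only at h1 h2 h3
    unfold g0
    rw [abs_mul, abs_mul]
    have e1 : |T1 p s| ≤ 1 := abs_le_one_of (by linarith) (by linarith)
    have e2 : |1 + T1 p s - T2 p r| ≤ 1 := abs_le_one_of (by linarith) (by linarith)
    have e3 := mul_le_one₀ e1 (abs_nonneg _) e2
    calc _ ≤ 1 * M := mul_le_mul e3 this (abs_nonneg _) zero_le_one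
      _ = M := one_mul M

lemma g1_nice {φ : ℝ × ℝ × ℝ → ℝ} (hc : ContinuousOn φ Dset) {M : ℝ}
    (hM : ∀ p ∈ Dset, |φ p| ≤ M) : Nice (T3set ×ˢ Ioo (0:ℝ) 1) (g1 φ) := by
  refine ⟨?_, M, ?_⟩
  · unfold g1
    apply ContinuousOn.mul
    · unfold T0 T1 T2; fun_prop
    · apply hc.comp (f := fun q : (((ℝ × ℝ × ℝ) × ℝ) × ℝ) × ℝ =>
        (T0 q.1.1.1 q.1.1.2, T1 q.1.1.1 q.1.2, T2 q.1.1.1 q.2))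
      · unfold T0 T1 T2; fun_prop
      · intro q hq
        exact mem1 hq.1.1.1 hq.1.1.2 hq.1.2 hq.2
  · rintro ⟨p, u⟩ ⟨hp, hu⟩ s hs r hr
    have hm := mem1 hp hu hs hr
    have := hM _ hm
    obtain ⟨⟨h1, h2, h3, h4⟩, -⟩ := hm
    simp only at h1 h2 h3 h4
    unfold g1
    simp only
    rw [abs_mul, abs_mul, abs_mul]
    have e1 : |T1 p s - T0 p u| ≤ 1 := abs_le_one_of (by linarith) (by linarith)
    have e2 : |T2 p r - T0 p u| ≤ 1 := abs_le_one_of (by linarith) (by linarith)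
    have e4 : |1 + T0 p u - T1 p s| ≤ 1 := abs_le_one_of (by linarith) (by linarith)
    have e3 := mul_le_one₀ (mul_le_one₀ e1 (abs_nonneg _) e2) (abs_nonneg _) e4
    calc _ ≤ 1 * M := mul_le_mul e3 this (abs_nonneg _) zero_le_one
      _ = M := one_mul M

lemma diag {p : ℝ × ℝ × ℝ} (hp : p ∈ T3set) (h : p.1 = p.2.2) :
    p.2.1 = p.1 ∧ p.2.2 = p.1 := by
  obtain ⟨h1, h2, h3, h4⟩ := hp
  constructor <;> linarith

lemma II_r : ∫ r in Ioo (0:ℝ) 1, r = 1 / 2 := by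
  have := int_pow 1; norm_num at this; simpa using this
lemma II_r2 : ∫ r in Ioo (0:ℝ) 1, r * r = 1 / 3 := by
  have := int_pow 2; norm_num at this; simp only [← pow_two, this]
lemma II_cr (c : ℝ) : ∫ r in Ioo (0:ℝ) 1, c * r = c * (1 / 2) := by
  rw [integral_const_mul, II_r]
lemma intOn_cont {f : ℝ → ℝ} (h : Continuous f) : IntegrableOn f (Ioo (0:ℝ) 1) :=
  (h.continuousOn.integrableOn_Icc).mono_set Ioo_subset_Icc_self
lemma II_1r : ∫ r in Ioo (0:ℝ) 1, (1 - r) = 1 / 2 := by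
  rw [integral_sub (intOn_cont (by fun_prop)) (intOn_cont (by fun_prop)), II_r]
  norm_num
lemma II_r1r : ∫ r in Ioo (0:ℝ) 1, (r * (1 - r)) = 1 / 6 := by
  simp only [mul_sub, mul_one]
  rw [integral_sub (intOn_cont (by fun_prop)) (intOn_cont (by fun_prop)), II_r, II_r2]
  norm_num

/-- change of variables back -/
lemma II_sub (f : ℝ → ℝ) : ∫ t in (-1:ℝ)..0, f t = ∫ s in Ioo (0:ℝ) 1, f (-1 + s) := by
  have := avg_eq (-1) 0 f
  simp only [avg] at this
  norm_num at this
  exact this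

lemma Bt1_eq {φ : ℝ × ℝ × ℝ → ℝ} (hc : ContinuousOn φ Dset) {M : ℝ}
    (hM : ∀ p ∈ Dset, |φ p| ≤ M) {p : ℝ × ℝ × ℝ} (hp : p ∈ T3set) :
    Bt1op φ p = lam p * ((∫ u in Ioo (0:ℝ) 1, mom (fun s _ => 1 - s) (g1 φ) (p, u)) -
      (∫ u in Ioo (0:ℝ) 1, mom (fun _ r => r) (g1 φ) (p, u)))
      + ∫ u in Ioo (0:ℝ) 1, mom (fun _ r => r) (g1 φ) (p, u) := by
  have hn := g1_nice hc hM
  have hint : ∀ {w : ℝ → ℝ → ℝ}, (Continuous fun q : ℝ × ℝ => w q.1 q.2) →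
      IntegrableOn (fun u => mom w (g1 φ) (p, u)) (Ioo 0 1) := by
    intro w hw
    obtain ⟨c, K, hK⟩ := mom_cont hn hw
    exact (CI (A := T3set) (F := fun p u => mom w (g1 φ) (p, u)) (M := K) c
      (fun x hx r hr => hK (x, r) ⟨hx, hr⟩)).2.2 p hp
  have w1 : Continuous fun q : ℝ × ℝ => (fun s (_ : ℝ) => 1 - s) q.1 q.2 := by fun_prop
  have w2 : Continuous fun q : ℝ × ℝ => (fun (_ : ℝ) r => r) q.1 q.2 := by fun_prop
  unfold Bt1op
  split_ifs with h
  · obtain ⟨e1, e2⟩ := diag hp h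
    have hl : lam p = 0 := by simp [lam, h]
    rw [hl, zero_mul, zero_add, avg_eq, ← integral_const_mul]
    congr 1; ext u
    simp only [mom, g1, T1, T2, e1, e2, sub_self, mul_zero, add_zero, integral_mul_const, II_r]
    simp only [integral_const, T0, MeasureTheory.measureReal_restrict_apply_univ,
      Real.volume_real_Ioo_of_le zero_le_one, smul_eq_mul]
    ring
  · have hne : p.2.2 - p.1 ≠ 0 := sub_ne_zero.mpr (Ne.symm h)
    simp only [avg_eq]
    have e : ∀ u ∈ Ioo (0:ℝ) 1, (∫ s in Ioo (0:ℝ) 1, ∫ r in Ioo (0:ℝ) 1,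
        Phi1 (-1 + u * (p.1 - -1)) (p.1 + s * (p.2.1 - p.1)) (p.2.1 + r * (p.2.2 - p.2.1)) p.1 p.2.2
        * φ (-1 + u * (p.1 - -1), p.1 + s * (p.2.1 - p.1), p.2.1 + r * (p.2.2 - p.2.1))) =
        lam p * mom (fun s _ => 1 - s) (g1 φ) (p, u) +
          (1 - lam p) * mom (fun _ r => r) (g1 φ) (p, u) := by
      intro u hu
      rw [← mom_lin hn w1 w2 _ _ (x := (p, u)) ⟨hp, hu⟩]
      unfold mom
      congr 1; ext s; congr 1; ext r
      unfold g1 T0 T1 T2 Phi1 lam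
      simp only
      rw [← mul_assoc]
      congr 1
      field_simp
      ring
    rw [setIntegral_congr_fun measurableSet_Ioo e, integral_add ((hint w1).const_mul _)
      ((hint w2).const_mul _), integral_const_mul, integral_const_mul]
    ring

lemma Bt1_cont {φ : ℝ × ℝ × ℝ → ℝ} (hc : ContinuousOn φ Dset) {M : ℝ}
    (hM : ∀ p ∈ Dset, |φ p| ≤ M) : ContinuousOn (Bt1op φ) T3set := by
  have hn := g1_nice hc hM
  have hint : ∀ {w : ℝ → ℝ → ℝ}, (Continuous fun q : ℝ × ℝ => w q.1 q.2) →
      ContinuousOn (fun p => ∫ u in Ioo (0:ℝ) 1, mom w (g1 φ) (p, u)) T3set := by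
    intro w hw
    obtain ⟨c, K, hK⟩ := mom_cont hn hw
    exact (CI (A := T3set) (F := fun p u => mom w (g1 φ) (p, u)) (M := K) c
      (fun x hx r hr => hK (x, r) ⟨hx, hr⟩)).1
  have w1 : Continuous fun q : ℝ × ℝ => (fun s (_ : ℝ) => 1 - s) q.1 q.2 := by fun_prop
  have w2 : Continuous fun q : ℝ × ℝ => (fun (_ : ℝ) r => r) q.1 q.2 := by fun_prop
  refine ContinuousOn.congr (ContinuousOn.add ?_ (hint (w := fun _ r => r) w2)) (fun p hp => Bt1_eq hc hM hp)
  intro p hp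
  have hd := ((hint (w := fun s _ => 1 - s) w1).sub (hint (w := fun _ r => r) w2)) p hp
  by_cases h : p.1 = p.2.2
  · apply mul_zero_cont (fun y hy => lam_bd hy) hd
    obtain ⟨e1, e2⟩ := diag hp h
    simp only [Pi.sub_apply]
    rw [sub_eq_zero]
    congr 1; ext u
    simp only [mom, g1, T1, T2, e1, e2, sub_self, mul_zero, add_zero, integral_mul_const, II_r]
    simp only [integral_const, T0, II_1r, integral_const_mul, integral_mul_const]
    simp
    left; rw [II_1r]; norm_num
  · exact (lam_cont h _).mul hd

lemma Bt1_bad (φ : ℝ × ℝ × ℝ → ℝ) : Bt1op φ badPt = Q1 φ := by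
  simp only [Bt1op, badPt, avg, Q1, Phi1]
  norm_num
  congr 1; ext t; ring

lemma B1_main {φ : ℝ × ℝ × ℝ → ℝ} (hc : ContinuousOn φ Dset) {M : ℝ}
    (hM : ∀ p ∈ Dset, |φ p| ≤ M) : ∃ ψ : ℝ × ℝ × ℝ → ℝ, ContinuousOn ψ T3set ∧ ψ badPt = 0 ∧
      ∀ p ∈ Dset, B1op φ p = ψ p + Q1 φ * nu1 p := by
  refine ⟨fun p => nu1 p * (Bt1op φ p - Q1 φ), ?_, ?_, ?_⟩
  · intro p hp
    have hd : ContinuousWithinAt (fun p => Bt1op φ p - Q1 φ) T3set p :=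
      ((Bt1_cont hc hM).sub continuousOn_const) p hp
    rcases T3_cases hp with h | h
    · refine ContinuousWithinAt.mul ?_ hd
      unfold nu1
      apply ContinuousAt.continuousWithinAt
      exact ContinuousAt.div (by fun_prop) (by fun_prop) (d_pos h).ne'
    · apply mul_zero_cont (fun y hy => nu1_bd hy) hd
      rw [h, Bt1_bad, sub_self]
  · simp [Bt1_bad]
  · intro p hp
    unfold B1op; ring

def wa (s r : ℝ) : ℝ := (1 - s) * (1 - r)
def wb (s r : ℝ) : ℝ := (1 - s) * r
def wc (_ r : ℝ) : ℝ := r * (1 - r)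
def wd (_ r : ℝ) : ℝ := r * r

lemma B0_eq {φ : ℝ × ℝ × ℝ → ℝ} (hc : ContinuousOn φ Dset) {M : ℝ}
    (hM : ∀ p ∈ Dset, |φ p| ≤ M) {p : ℝ × ℝ × ℝ} (hp : p ∈ Dset) :
    B0op φ p = (lam p * ((p.2.1 * mom wa (g0 φ) p + p.2.2 * mom wb (g0 φ) p) -
      (p.2.1 * mom wc (g0 φ) p + p.2.2 * mom wd (g0 φ) p)) +
      (p.2.1 * mom wc (g0 φ) p + p.2.2 * mom wd (g0 φ) p)) / (1 + p.1 - p.2.1) := by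
  have hn := g0_nice hc hM
  have hd := d_pos hp
  unfold B0op
  split_ifs with h
  · obtain ⟨e1, e2⟩ := diag hp.1 h
    have hl : lam p = 0 := by simp [lam, h]
    simp only [hl, mom, g0, T1, T2, e1, e2, sub_self, mul_zero, add_zero, integral_mul_const,
      wc, wd, II_r1r, II_r2]
    simp
    ring
  · have hne : p.2.2 - p.1 ≠ 0 := sub_ne_zero.mpr (Ne.symm h)
    simp only [avg_eq]
    have ca : Continuous fun q : ℝ × ℝ => wa q.1 q.2 := by unfold wa; fun_prop
    have cb : Continuous fun q : ℝ × ℝ => wb q.1 q.2 := by unfold wb; fun_prop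
    have cc : Continuous fun q : ℝ × ℝ => wc q.1 q.2 := by unfold wc; fun_prop
    have cd : Continuous fun q : ℝ × ℝ => wd q.1 q.2 := by unfold wd; fun_prop
    have l1 := mom_lin hn ca cb p.2.1 p.2.2 hp.1
    have l2 := mom_lin hn cc cd p.2.1 p.2.2 hp.1
    have l3 := mom_lin hn (w₁ := fun s r => p.2.1 * wa s r + p.2.2 * wb s r)
      (w₂ := fun s r => p.2.1 * wc s r + p.2.2 * wd s r) (by fun_prop) (by fun_prop)
      (lam p / (1 + p.1 - p.2.1)) ((1 - lam p) / (1 + p.1 - p.2.1)) hp.1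
    rw [l1, l2] at l3
    trans (lam p / (1 + p.1 - p.2.1) * (p.2.1 * mom wa (g0 φ) p + p.2.2 * mom wb (g0 φ) p) +
      (1 - lam p) / (1 + p.1 - p.2.1) * (p.2.1 * mom wc (g0 φ) p + p.2.2 * mom wd (g0 φ) p))
    · rw [← l3]
      unfold mom
      congr 1; ext s; congr 1; ext r
      unfold g0 T1 T2 Phi0 lam wa wb wc wd
      rw [← mul_assoc]
      congr 1
      have := hd.ne'
      field_simp
      ring
    · ring

lemma B0_bad (φ : ℝ × ℝ × ℝ → ℝ) : mom wa (g0 φ) badPt = - Q0 φ ∧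
    mom wb (g0 φ) badPt = - Q0 φ := by
  have e : ∀ s r : ℝ, g0 φ badPt s r = (-1 + s) * s * φ (-1 + s, 0, 0) := by
    intro s r; simp [g0, T1, T2, badPt]
  constructor
  · simp only [mom, e, wa, Q0, II_sub, integral_mul_const, integral_const_mul, II_1r]
    rw [← integral_const_mul, ← integral_neg]
    congr 1; ext s; ring
  · simp only [mom, e, wb, Q0, II_sub, integral_mul_const, integral_const_mul, II_cr]
    rw [← integral_const_mul, ← integral_neg]
    congr 1; ext s; ring

lemma B0_main {φ : ℝ × ℝ × ℝ → ℝ} (hc : ContinuousOn φ Dset) {M : ℝ}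
    (hM : ∀ p ∈ Dset, |φ p| ≤ M) : ∃ ψ : ℝ × ℝ × ℝ → ℝ, ContinuousOn ψ T3set ∧ ψ badPt = 0 ∧
      ∀ p ∈ Dset, B0op φ p = ψ p + Q0 φ * nu0 p := by
  have hn := g0_nice hc hM
  have ca := (mom_cont hn (w := wa) (by unfold wa; fun_prop)).1
  have cb := (mom_cont hn (w := wb) (by unfold wb; fun_prop)).1
  have cc := (mom_cont hn (w := wc) (by unfold wc; fun_prop)).1
  have cd := (mom_cont hn (w := wd) (by unfold wd; fun_prop)).1
  obtain ⟨ba, bb⟩ := B0_bad φ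
  set a := mom wa (g0 φ) with ha
  set b := mom wb (g0 φ) with hb
  set c := mom wc (g0 φ) with hcc
  set d := mom wd (g0 φ) with hdd
  have hlb : lam badPt = 1 := by simp [lam, badPt]
  refine ⟨fun p => p.2.1 / (1 + p.1 - p.2.1) * (lam p * (a p - c p) + c p + Q0 φ) +
    p.2.2 / (1 + p.1 - p.2.1) * (lam p * (b p - d p) + d p + Q0 φ), ?_, ?_, ?_⟩
  · intro p hp
    have k1 : ContinuousWithinAt (fun p : ℝ × ℝ × ℝ => p.2.1) T3set p := by fun_prop
    have k2 : ContinuousWithinAt (fun p : ℝ × ℝ × ℝ => p.2.2) T3set p := by fun_prop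
    rcases T3_cases hp with h | h
    · have hdc : ContinuousWithinAt (fun p : ℝ × ℝ × ℝ => 1 + p.1 - p.2.1) T3set p := by fun_prop
      have hP2 := (k1.mul (cc p hp)).add (k2.mul (cd p hp))
      have hP := ((k1.mul (ca p hp)).add (k2.mul (cb p hp))).sub hP2
      have hL : ContinuousWithinAt (fun p => lam p * ((p.2.1 * a p + p.2.2 * b p) -
          (p.2.1 * c p + p.2.2 * d p))) T3set p := by
        by_cases hdg : p.1 = p.2.2
        · apply mul_zero_cont (fun y hy => lam_bd hy) hP
          obtain ⟨e1, e2⟩ := diag hp hdg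
          simp only [Pi.add_apply, Pi.mul_apply, Pi.sub_apply]
          simp only [ha, hb, hcc, hdd, mom, g0, T1, T2, e1, e2, sub_self, mul_zero, add_zero,
            integral_mul_const, integral_const_mul, wa, wb, wc, wd, II_r1r, II_r2, II_cr, II_1r]
          simp
          ring
        · exact (lam_cont hdg _).mul hP
      have := ((hL.add hP2).add ((k1.add k2).const_mul (Q0 φ))).div hdc (d_pos h).ne'
      refine this.congr (fun y _ => ?_) ?_
      · simp only [Pi.add_apply, Pi.mul_apply, Pi.sub_apply, Pi.div_apply]
        ring
      · simp only [Pi.add_apply, Pi.mul_apply, Pi.sub_apply, Pi.div_apply]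
        ring
    · have hl : ContinuousWithinAt lam T3set p := lam_cont (by rw [h]; simp [badPt]) _
      apply ContinuousWithinAt.add
      · apply mul_zero_cont (K := 1)
        · intro y hy
          have hd := d_nonneg hy
          obtain ⟨h1, h2, h3, h4⟩ := hy
          rw [abs_div, abs_of_nonneg hd, abs_of_nonpos (by linarith)]
          exact div_le_of_le_mul₀ (by linarith) (by linarith) (by linarith)
        · exact ((hl.mul ((ca p hp).sub (cc p hp))).add (cc p hp)).add
            continuousWithinAt_const
        · rw [h, hlb, ba]; ring
      · apply mul_zero_cont (K := 1)
        · intro y hy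
          have hd := d_nonneg hy
          obtain ⟨h1, h2, h3, h4⟩ := hy
          rw [abs_div, abs_of_nonneg hd, abs_of_nonpos (by linarith)]
          exact div_le_of_le_mul₀ (by linarith) (by linarith) (by linarith)
        · exact ((hl.mul ((cb p hp).sub (cd p hp))).add (cd p hp)).add
            continuousWithinAt_const
        · rw [h, hlb, bb]; ring
  · simp [badPt]
  · intro p hp
    rw [B0_eq hc hM hp, nu0]
    ring

lemma B_main {φ : ℝ × ℝ × ℝ → ℝ} (h : InCV φ) :
      ∃ ψ : ℝ × ℝ × ℝ → ℝ, ContinuousOn ψ T3set ∧ ψ badPt = 0 ∧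
        ∀ p ∈ Dset, Bop3 φ p = Q0 φ * nu0 p + Q1 φ * nu1 p + ψ p := by
  obtain ⟨hc, M, hM⟩ := InCV_cont h
  obtain ⟨ψ0, h0, b0, e0⟩ := B0_main hc hM
  obtain ⟨ψ1, h1, b1, e1⟩ := B1_main hc hM
  refine ⟨fun p => ψ0 p + ψ1 p, h0.add h1, by simp [b0, b1], fun p hp => ?_⟩
  unfold Bop3
  rw [e0 p hp, e1 p hp]; ring

lemma cont_InCV {g : ℝ × ℝ × ℝ → ℝ} (h : ContinuousOn g T3set) : InCV g :=
  ⟨g, h, 0, 0, fun p _ => by simp⟩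

lemma Q_surj (q₀ q₁ : ℝ) : ∃ φ : ℝ × ℝ × ℝ → ℝ,
      ContinuousOn φ T3set ∧ Q0 φ = q₀ ∧ Q1 φ = q₁ := by
  have i2 : ∫ t in (-1:ℝ)..0, t ^ 2 * (1 + t) = 1 / 12 := by
    simp only [mul_add, mul_one, ← pow_succ]
    rw [intervalIntegral.integral_add (Continuous.intervalIntegrable (by fun_prop) _ _)
      (Continuous.intervalIntegrable (by fun_prop) _ _)]
    simp only [integral_pow]
    norm_num
  have i3 : ∫ t in (-1:ℝ)..0, t ^ 3 * (1 + t) = - 1 / 20 := by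
    simp only [mul_add, mul_one, ← pow_succ]
    rw [intervalIntegral.integral_add (Continuous.intervalIntegrable (by fun_prop) _ _)
      (Continuous.intervalIntegrable (by fun_prop) _ _)]
    simp only [integral_pow]
    norm_num
  refine ⟨fun p => 24 * q₀ + 20 * (2 * q₀ - q₁) * p.2.1, by fun_prop, ?_, ?_⟩
  · simp only [Q0, mul_zero, add_zero, intervalIntegral.integral_mul_const, i2]
    ring
  · have : ∀ t : ℝ, t ^ 2 * (1 + t) * (24 * q₀ + 20 * (2 * q₀ - q₁) * t) =
      (t ^ 2 * (1 + t)) * (24 * q₀) + (t ^ 3 * (1 + t)) * (20 * (2 * q₀ - q₁)) := by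
      intro t; ring
    simp only [Q1, this]
    rw [intervalIntegral.integral_add (Continuous.intervalIntegrable (by fun_prop) _ _)
      (Continuous.intervalIntegrable (by fun_prop) _ _)]
    simp only [intervalIntegral.integral_mul_const, i2, i3]
    ring

theorem statement18 :
    -- `B₀`, `B₁` and `B = B₀ + B₁` map `C_V` into `C_{0,V}`
    (∀ φ : ℝ × ℝ × ℝ → ℝ, InCV φ →
      InC0V (B0op φ) ∧ InC0V (B1op φ) ∧ InC0V (Bop3 φ)) ∧
    -- the explicit decomposition of `Bφ`
    (∀ φ : ℝ × ℝ × ℝ → ℝ, InCV φ →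
      ∃ ψ : ℝ × ℝ × ℝ → ℝ, ContinuousOn ψ T3set ∧ ψ badPt = 0 ∧
        ∀ p ∈ Dset, Bop3 φ p = Q0 φ * nu0 p + Q1 φ * nu1 p + ψ p) ∧
    -- every pair `(Q₀, Q₁)` arises from some continuous `φ`
    (∀ q₀ q₁ : ℝ, ∃ φ : ℝ × ℝ × ℝ → ℝ,
      ContinuousOn φ T3set ∧ Q0 φ = q₀ ∧ Q1 φ = q₁) ∧
    -- `C_V` contains (the restrictions of) all continuous functions on `T₃`
    (∀ g : ℝ × ℝ × ℝ → ℝ, ContinuousOn g T3set → InCV g) ∧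
    -- `C_V` is closed under uniform approximation (on `T₃ ∖ {(-1,0,0)}`)
    -- within the bounded functions
    (∀ f : ℝ × ℝ × ℝ → ℝ, (∃ Mb : ℝ, ∀ p ∈ Dset, |f p| ≤ Mb) →
      (∀ ε : ℝ, 0 < ε → ∃ g : ℝ × ℝ × ℝ → ℝ, InCV g ∧ ∀ p ∈ Dset, |f p - g p| ≤ ε) →
      InCV f) ∧
    -- and `C_V` is the smallest such space: every subspace of the bounded functions on
    -- `T₃ ∖ {(-1,0,0)}` (identified via their values there) which is closed under uniform
    -- convergence, contains the restrictions of all continuous functions on `T₃`, and is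
    -- invariant under `B`, contains `C_V`
    (∀ S : Set ((ℝ × ℝ × ℝ) → ℝ),
      (∀ f ∈ S, ∀ g : ℝ × ℝ × ℝ → ℝ, (∀ p ∈ Dset, g p = f p) → g ∈ S) →
      (∀ f ∈ S, ∀ g ∈ S, f + g ∈ S) →
      (∀ c : ℝ, ∀ f ∈ S, c • f ∈ S) →
      (∀ f ∈ S, ∃ Mb : ℝ, ∀ p ∈ Dset, |f p| ≤ Mb) →
      (∀ f : ℝ × ℝ × ℝ → ℝ, (∃ Mb : ℝ, ∀ p ∈ Dset, |f p| ≤ Mb) →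
        (∀ ε : ℝ, 0 < ε → ∃ g ∈ S, ∀ p ∈ Dset, |f p - g p| ≤ ε) → f ∈ S) →
      (∀ g : ℝ × ℝ × ℝ → ℝ, ContinuousOn g T3set → g ∈ S) →
      (∀ f ∈ S, Bop3 f ∈ S) →
      ∀ φ : ℝ × ℝ × ℝ → ℝ, InCV φ → φ ∈ S) := by
  refine ⟨?_, fun φ h => B_main h, Q_surj, fun g h => cont_InCV h, fun f _ h => CV_closed f h, ?_⟩
  · intro φ h
    obtain ⟨hc, M, hM⟩ := InCV_cont h
    refine ⟨?_, ?_, ?_⟩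
    · obtain ⟨ψ0, h0, b0, e0⟩ := B0_main hc hM
      exact ⟨ψ0, h0, b0, Q0 φ, 0, fun p hp => by rw [e0 p hp]; ring⟩
    · obtain ⟨ψ1, h1, b1, e1⟩ := B1_main hc hM
      exact ⟨ψ1, h1, b1, 0, Q1 φ, fun p hp => by rw [e1 p hp]; ring⟩
    · obtain ⟨ψ, h0, b0, e0⟩ := B_main h
      exact ⟨ψ, h0, b0, Q0 φ, Q1 φ, fun p hp => by rw [e0 p hp]; ring⟩
  · intro S hcongr hadd hsmul _ _ hcont hB
    have key : ∀ q₀ q₁ : ℝ, (fun p => q₀ * nu0 p + q₁ * nu1 p) ∈ S := by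
      intro q₀ q₁
      obtain ⟨f, hf, rfl, rfl⟩ := Q_surj q₀ q₁
      obtain ⟨ψ, h0, b0, e0⟩ := B_main (cont_InCV hf)
      apply hcongr _ (hadd _ (hB f (hcont f hf)) _ (hsmul (-1) _ (hcont ψ h0)))
      intro p hp
      simp only [Pi.add_apply, Pi.smul_apply, smul_eq_mul, e0 p hp]
      ring
    rintro φ ⟨ψ, hψ, c0, c1, e⟩
    apply hcongr _ (hadd _ (hcont ψ hψ) _ (key c0 c1))
    intro p hp
    simp only [Pi.add_apply, e p hp]
    ring
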